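/- For all integers n ≥ 0 and k ≥ 2, the map ℰ sending a partition P of {1,…,n} to the 01-filling of the triangular shape △_n that has a 1 in cell (j, i) if and only if (i,j) with i ≤ j is an arc or loop of the arc diagram of P, is a bijection from the set of enhanced k-noncrossing partitions of {1,…,n} onto the set ℰ_n^{(k)} of 01-fillings of △_n with at most one 1 in each row, at most one 1 in each column, no proper SE-chain of length k, and such that for every i ∈ {1,…,n} either row i or column i contains a 1. -/

import Mathlib

open Finset Polynomial

/-- `(i,j)` with `i < j` is an arc of the arc diagram of `P`: `i` and `j` lie in a common
block `B` and no element of `B` is strictly between them. -/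
def IsArc {s : Finset ℕ} (P : Finpartition s) (i j : ℕ) : Prop :=
  i < j ∧ ∃ B ∈ P.parts, i ∈ B ∧ j ∈ B ∧ ∀ l ∈ B, ¬(i < l ∧ l < j)

/-- `(i,j)` is an arc or a loop (`i = j` and `{i}` a singleton block) of the arc diagram. -/
def IsDiagArc {s : Finset ℕ} (P : Finpartition s) (i j : ℕ) : Prop :=
  IsArc P i j ∨ (i = j ∧ {i} ∈ P.parts)

/-- `P` has a `k`-crossing: arcs `(i₁,j₁),…,(i_k,j_k)` with `i₁<⋯<i_k<j₁<⋯<j_k`. -/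
def HasKCrossing {s : Finset ℕ} (P : Finpartition s) (k : ℕ) : Prop :=
  ∃ f g : Fin k → ℕ,
    StrictMono f ∧ StrictMono g ∧ (∀ m, IsDiagArc P (f m) (g m)) ∧
    ∀ a b : Fin k, f a < g b

/-- `P` has a weak `k`-crossing: arcs `(i₁,j₁),…,(i_k,j_k)` with
`i₁<⋯<i_k = j₁<⋯<j_k` (the largest left endpoint equals the smallest right endpoint). -/
def HasWeakKCrossing {s : Finset ℕ} (P : Finpartition s) (k : ℕ) : Prop :=
  ∃ f g : Fin k → ℕ,
    StrictMono f ∧ StrictMono g ∧ (∀ m, IsDiagArc P (f m) (g m)) ∧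
    ∃ a b : Fin k, f a = g b ∧ (∀ c, f c ≤ f a) ∧ (∀ c, g b ≤ g c)

/-- `P` has an enhanced `k`-crossing: a `k`-crossing or a weak `k`-crossing. -/
def HasEnhancedKCrossing {s : Finset ℕ} (P : Finpartition s) (k : ℕ) : Prop :=
  HasKCrossing P k ∨ HasWeakKCrossing P k

open scoped Classical in
/-- The generating polynomial `∑ t^{number of blocks}` over the partitions of `s`
satisfying the predicate `pr`. -/
noncomputable def partPoly (s : Finset ℕ) (pr : Finpartition s → Prop) : Polynomial ℤ :=
  ∑ P : Finpartition s, if pr P then (X : Polynomial ℤ) ^ P.parts.card else 0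


/-- The triangular shape `△_n`: cells `(r,c)` with `1 ≤ c ≤ r ≤ n`. -/
def triangle (n : ℕ) : Finset (ℕ × ℕ) :=
  (Finset.Icc 1 n ×ˢ Finset.Icc 1 n).filter (fun p => p.2 ≤ p.1)

/-- At most one `1` in each row and at most one `1` in each column. -/
def RowColAtMostOne (F : Finset (ℕ × ℕ)) : Prop :=
  (∀ p ∈ F, ∀ q ∈ F, p.1 = q.1 → p = q) ∧ ∀ p ∈ F, ∀ q ∈ F, p.2 = q.2 → p = q

/-- `F` has a proper SE-chain of length `k`. -/
def HasProperSEChain (F : Finset (ℕ × ℕ)) (k : ℕ) : Prop :=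
  ∃ f : Fin k → ℕ × ℕ, (∀ m, f m ∈ F) ∧ StrictMono (fun m => (f m).1) ∧
    StrictMono (fun m => (f m).2) ∧ ∀ a b : Fin k, (f b).2 ≤ (f a).1

open scoped Classical in
/-- The map `ℰ`: the filling of `△_n` with a `1` in cell `(j,i)` iff `(i,j)`, `i ≤ j`,
is an arc or loop of the arc diagram of `P`. -/
noncomputable def EMap (n : ℕ) (P : Finpartition (Finset.Icc 1 n)) : Finset (ℕ × ℕ) :=
  (triangle n).filter (fun rc => IsDiagArc P rc.2 rc.1)

section Arcs

variable {s : Finset ℕ} {P Q : Finpartition s} {i j i' j' : ℕ}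

theorem IsDiagArc.le (h : IsDiagArc P i j) : i ≤ j := by
  rcases h with h | h
  · exact h.1.le
  · exact h.1.le

theorem IsDiagArc.exists_mem_parts (h : IsDiagArc P i j) : ∃ B ∈ P.parts, i ∈ B ∧ j ∈ B := by
  rcases h with ⟨-, B, hB, hi, hj, -⟩ | ⟨rfl, h⟩
  · exact ⟨B, hB, hi, hj⟩
  · exact ⟨{i}, h, by simp, by simp⟩

theorem IsDiagArc.left_unique (h : IsDiagArc P i j) (h' : IsDiagArc P i' j) : i = i' := by
  rcases h with ⟨hij, B, hB, hi, hj, hl⟩ | ⟨rfl, h⟩ <;>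
    rcases h' with ⟨hij', B', hB', hi', hj', hl'⟩ | ⟨rfl, h'⟩
  · obtain rfl := P.eq_of_mem_parts hB hB' hj hj'
    have := hl _ hi'
    have := hl' _ hi
    lia
  · obtain rfl := P.eq_of_mem_parts hB h' hj (by simp)
    simpa using hi
  · obtain rfl := P.eq_of_mem_parts hB' h hj' (by simp)
    exact (Finset.mem_singleton.1 hi').symm
  · rfl

theorem IsDiagArc.right_unique (h : IsDiagArc P i j) (h' : IsDiagArc P i j') : j = j' := by
  rcases h with ⟨hij, B, hB, hi, hj, hl⟩ | ⟨rfl, h⟩ <;>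
    rcases h' with ⟨hij', B', hB', hi', hj', hl'⟩ | ⟨rfl, h'⟩
  · obtain rfl := P.eq_of_mem_parts hB hB' hi hi'
    have := hl _ hj'
    have := hl' _ hj
    lia
  · obtain rfl := P.eq_of_mem_parts hB h' hi (by simp)
    simpa using hj
  · obtain rfl := P.eq_of_mem_parts hB' h hi' (by simp)
    exact (Finset.mem_singleton.1 hj').symm
  · rfl

theorem exists_isArc_left {B : Finset ℕ} (hB : B ∈ P.parts) (hi : i ∈ B) (hj : j ∈ B)
    (hij : i < j) : ∃ l ∈ B, i ≤ l ∧ IsArc P l j := by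
  have hne : (B.filter (· < j)).Nonempty := ⟨i, by simp [hi, hij]⟩
  have hmem := Finset.max'_mem _ hne
  have hmax := Finset.le_max' (B.filter (· < j))
  rw [Finset.mem_filter] at hmem
  refine ⟨_, hmem.1, hmax i (by simp [hi, hij]), hmem.2, B, hB, hmem.1, hj, fun l hl h => ?_⟩
  exact absurd (hmax l (by simp [hl, h.2])) (not_le.2 h.1)

theorem exists_isArc_right {B : Finset ℕ} (hB : B ∈ P.parts) (hi : i ∈ B) (hj : j ∈ B)
    (hij : i < j) : ∃ l, IsArc P i l := by
  have hne : (B.filter (i < ·)).Nonempty := ⟨j, by simp [hj, hij]⟩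
  have hmem := Finset.min'_mem _ hne
  have hmin := Finset.min'_le (B.filter (i < ·))
  rw [Finset.mem_filter] at hmem
  refine ⟨_, hmem.2, B, hB, hi, hmem.1, fun l hl h => ?_⟩
  exact absurd (hmin l (by simp [hl, h.1])) (not_le.2 h.2)

theorem exists_isDiagArc (hi : i ∈ s) : ∃ l, IsDiagArc P l i ∨ IsDiagArc P i l := by
  obtain ⟨B, hB, hiB⟩ := P.exists_mem hi
  by_cases h : ∃ j ∈ B, j ≠ i
  · obtain ⟨j, hj, hne⟩ := h
    rcases lt_or_gt_of_ne hne with hlt | hlt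
    · obtain ⟨l, -, -, hl⟩ := exists_isArc_left hB hj hiB hlt
      exact ⟨l, .inl (.inl hl)⟩
    · obtain ⟨l, hl⟩ := exists_isArc_right hB hiB hj hlt
      exact ⟨l, .inr (.inl hl)⟩
  · push Not at h
    obtain rfl : B = {i} := Finset.eq_singleton_iff_unique_mem.2 ⟨hiB, h⟩
    exact ⟨i, .inl (.inr ⟨rfl, hB⟩)⟩

theorem exists_common_part_of_isDiagArc_imp (h : ∀ a b, IsDiagArc P a b → IsDiagArc Q a b)
    {B : Finset ℕ} (hB : B ∈ P.parts) (hi : i ∈ B) (hj : j ∈ B) (hij : i ≤ j) :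
    ∃ C ∈ Q.parts, i ∈ C ∧ j ∈ C := by
  induction j using Nat.strong_induction_on with
  | _ j ih =>
    rcases hij.eq_or_lt with rfl | hlt
    · obtain ⟨C, hC, hiC⟩ := Q.exists_mem (P.le hB hi)
      exact ⟨C, hC, hiC, hiC⟩
    · obtain ⟨l, hl, hil, harc⟩ := exists_isArc_left hB hi hj hlt
      obtain ⟨C, hC, hiC, hlC⟩ := ih l harc.1 hl hil
      obtain ⟨D, hD, hlD, hjD⟩ := (h l j (.inl harc)).exists_mem_parts
      obtain rfl := Q.eq_of_mem_parts hC hD hlC hlD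
      exact ⟨C, hC, hiC, hjD⟩

theorem le_of_isDiagArc_imp (h : ∀ a b, IsDiagArc P a b → IsDiagArc Q a b) : P ≤ Q := by
  intro B hB
  obtain ⟨a, ha⟩ := P.nonempty_of_mem_parts hB
  obtain ⟨C, hC, haC⟩ := Q.exists_mem (P.le hB ha)
  refine ⟨C, hC, fun b hb => ?_⟩
  have : ∃ D ∈ Q.parts, a ∈ D ∧ b ∈ D := by
    rcases le_total a b with hab | hab
    · exact exists_common_part_of_isDiagArc_imp h hB ha hb hab
    · obtain ⟨D, hD, hbD, haD⟩ := exists_common_part_of_isDiagArc_imp h hB hb ha hab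
      exact ⟨D, hD, haD, hbD⟩
  obtain ⟨D, hD, haD, hbD⟩ := this
  obtain rfl := Q.eq_of_mem_parts hC hD haC haD
  exact hbD

end Arcs

section EMap

variable {n k : ℕ} {P : Finpartition (Finset.Icc 1 n)}

theorem mem_EMap {p : ℕ × ℕ} : p ∈ EMap n P ↔ IsDiagArc P p.2 p.1 := by
  classical
  rw [EMap, Finset.mem_filter, and_iff_right_iff_imp]
  intro h
  obtain ⟨B, hB, h2, h1⟩ := h.exists_mem_parts
  have := P.le hB h1
  have := P.le hB h2
  simp_all [triangle, h.le]

theorem EMap_subset_triangle : EMap n P ⊆ triangle n := by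
  classical
  exact Finset.filter_subset _ _

theorem EMap_injective (n : ℕ) : Function.Injective (EMap n) := by
  intro P Q h
  have key : ∀ a b, IsDiagArc P a b ↔ IsDiagArc Q a b := fun a b => by
    rw [← mem_EMap (p := (b, a)), h, mem_EMap]
  exact le_antisymm (le_of_isDiagArc_imp fun a b => (key a b).1)
    (le_of_isDiagArc_imp fun a b => (key a b).2)

theorem rowColAtMostOne_EMap : RowColAtMostOne (EMap n P) := by
  refine ⟨fun p hp q hq h => ?_, fun p hp q hq h => ?_⟩ <;> rw [mem_EMap] at hp hq
  · exact Prod.ext h (hp.left_unique (h ▸ hq))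
  · exact Prod.ext (hp.right_unique (h ▸ hq)) h

theorem hasProperSEChain_EMap_iff (hk : k ≠ 0) :
    HasProperSEChain (EMap n P) k ↔ HasEnhancedKCrossing P k := by
  obtain ⟨k, rfl⟩ := Nat.exists_eq_succ_of_ne_zero hk
  constructor
  · rintro ⟨f, hf, h1, h2, h⟩
    have hd : ∀ m, IsDiagArc P (f m).2 (f m).1 := fun m => mem_EMap.1 (hf m)
    have hle : ∀ c, (f c).2 ≤ (f (Fin.last k)).2 := fun c => h2.monotone (Fin.le_last c)
    have hge : ∀ c, (f 0).1 ≤ (f c).1 := fun c => h1.monotone (Fin.zero_le c)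
    rcases (h 0 (Fin.last k)).lt_or_eq with hlt | heq
    · exact .inl ⟨_, _, h2, h1, hd, fun a b => (hle a).trans_lt (hlt.trans_le (hge b))⟩
    · exact .inr ⟨_, _, h2, h1, hd, Fin.last k, 0, heq, hle, hge⟩
  · rintro (⟨f, g, hf, hg, hd, h⟩ | ⟨f, g, hf, hg, hd, a, b, hab, hle, hge⟩)
    · exact ⟨fun m => (g m, f m), fun m => mem_EMap.2 (hd m), hg, hf, fun a b => (h b a).le⟩
    · exact ⟨fun m => (g m, f m), fun m => mem_EMap.2 (hd m), hg, hf,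
        fun c d => (hle d).trans (hab.le.trans (hge c))⟩

end EMap

section Filling

open Relation

/-- The steps `i → j` with `i < j` recorded by the off-diagonal cells of a filling. -/
def FillingStep (F : Finset (ℕ × ℕ)) (i j : ℕ) : Prop :=
  i < j ∧ (j, i) ∈ F

variable {F : Finset (ℕ × ℕ)} {i j : ℕ}

theorem FillingStep.rightUnique (hF : RowColAtMostOne F) : Relator.RightUnique (FillingStep F) :=
  fun _ _ _ h h' => congrArg Prod.fst (hF.2 _ h.2 _ h'.2 rfl)

theorem FillingStep.swap_rightUnique (hF : RowColAtMostOne F) :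
    Relator.RightUnique (Function.swap (FillingStep F)) :=
  fun _ _ _ h h' => congrArg Prod.snd (hF.1 _ h.2 _ h'.2 rfl)

theorem le_of_reflTransGen_fillingStep (h : ReflTransGen (FillingStep F) i j) : i ≤ j := by
  induction h with
  | refl => exact le_rfl
  | tail _ h ih => exact ih.trans h.1.le

/-- Two numbers are equivalent when one is reached from the other by steps of the filling. -/
def fillingSetoid (hF : RowColAtMostOne F) : Setoid ℕ where
  r i j := ReflTransGen (FillingStep F) i j ∨ ReflTransGen (FillingStep F) j i
  iseqv :=
    { refl := fun _ => .inl .refl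
      symm := Or.symm
      trans := by
        rintro a b c (hab | hba) (hbc | hcb)
        · exact .inl (hab.trans hbc)
        · have := ReflTransGen.total_of_right_unique (FillingStep.swap_rightUnique hF)
            (reflTransGen_swap.2 hab) (reflTransGen_swap.2 hcb)
          exact this.symm.imp reflTransGen_swap.1 reflTransGen_swap.1
        · exact ReflTransGen.total_of_right_unique (FillingStep.rightUnique hF) hba hbc
        · exact .inr (hcb.trans hba) }

theorem fillingSetoid_iff_of_le (hF : RowColAtMostOne F) (hij : i ≤ j) :
    fillingSetoid hF i j ↔ ReflTransGen (FillingStep F) i j := by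
  refine ⟨?_, .inl⟩
  rintro (h | h)
  · exact h
  · obtain rfl := hij.antisymm (le_of_reflTransGen_fillingStep h)
    exact .refl

open scoped Classical in
/-- The partition of `{1,…,n}` into the classes of `fillingSetoid`. -/
noncomputable def fillingPartition (n : ℕ) (hF : RowColAtMostOne F) :
    Finpartition (Finset.Icc 1 n) :=
  .ofSetSetoid (fillingSetoid hF) (Finset.Icc 1 n)

variable {n : ℕ}

theorem exists_common_part_fillingPartition_iff (hF : RowColAtMostOne F) :
    (∃ B ∈ (fillingPartition n hF).parts, i ∈ B ∧ j ∈ B) ↔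
      i ∈ Finset.Icc 1 n ∧ j ∈ Finset.Icc 1 n ∧ fillingSetoid hF i j := by
  classical
  rw [← Finpartition.mem_part_ofSetSetoid_iff_rel, Finpartition.mem_part_iff_exists]
  simp only [and_comm (a := i ∈ _), fillingPartition]

theorem mem_Icc_of_mem_filling (hT : F ⊆ triangle n) (h : (j, i) ∈ F) :
    i ∈ Finset.Icc 1 n ∧ j ∈ Finset.Icc 1 n ∧ i ≤ j := by
  have := hT h
  simp only [triangle, Finset.mem_filter, Finset.mem_product] at this
  exact ⟨this.1.2, this.1.1, this.2⟩

theorem isArc_fillingPartition_iff (hF : RowColAtMostOne F) (hT : F ⊆ triangle n) :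
    IsArc (fillingPartition n hF) i j ↔ FillingStep F i j := by
  constructor
  · rintro ⟨hij, B, hB, hi, hj, hl⟩
    have h := ((exists_common_part_fillingPartition_iff hF).1 ⟨B, hB, hi, hj⟩).2.2
    rw [fillingSetoid_iff_of_le hF hij.le] at h
    rcases h.cases_head with rfl | ⟨m, him, hmj⟩
    · exact absurd hij (lt_irrefl _)
    · have hm := mem_Icc_of_mem_filling hT him.2
      obtain ⟨C, hC, hiC, hmC⟩ :=
        (exists_common_part_fillingPartition_iff (n := n) hF).2 ⟨hm.1, hm.2.1, .inl (.single him)⟩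
      obtain rfl := Finpartition.eq_of_mem_parts _ hB hC hi hiC
      obtain rfl : m = j := (le_of_reflTransGen_fillingStep hmj).antisymm
        (not_lt.1 fun h => hl m hmC ⟨him.1, h⟩)
      exact him
  · intro h
    have hm := mem_Icc_of_mem_filling hT h.2
    obtain ⟨B, hB, hi, hj⟩ :=
      (exists_common_part_fillingPartition_iff (n := n) hF).2 ⟨hm.1, hm.2.1, .inl (.single h)⟩
    refine ⟨h.1, B, hB, hi, hj, fun l hl hlt => ?_⟩
    have hil := ((exists_common_part_fillingPartition_iff hF).1 ⟨B, hB, hi, hl⟩).2.2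
    rw [fillingSetoid_iff_of_le hF hlt.1.le] at hil
    rcases hil.cases_head with rfl | ⟨m, him, hml⟩
    · exact lt_irrefl _ hlt.1
    · obtain rfl := FillingStep.rightUnique hF h him
      exact absurd (le_of_reflTransGen_fillingStep hml) (not_le.2 hlt.2)

theorem singleton_mem_fillingPartition_iff (hF : RowColAtMostOne F) (hT : F ⊆ triangle n)
    (hcov : ∀ i ∈ Finset.Icc 1 n, ∃ p ∈ F, p.1 = i ∨ p.2 = i) :
    {i} ∈ (fillingPartition n hF).parts ↔ (i, i) ∈ F := by
  constructor
  · intro h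
    have hi := (fillingPartition n hF).le h (Finset.mem_singleton_self i)
    have loop : ∀ a b, (b, a) ∈ F → i = a ∨ i = b → (i, i) ∈ F := by
      intro a b hab hi'
      rcases (mem_Icc_of_mem_filling hT hab).2.2.eq_or_lt with rfl | hlt
      · rcases hi' with rfl | rfl <;> exact hab
      · obtain ⟨-, B, hB, ha, hb, -⟩ := (isArc_fillingPartition_iff hF hT).2 ⟨hlt, hab⟩
        have hiB : i ∈ B := by rcases hi' with rfl | rfl <;> assumption
        obtain rfl := Finpartition.eq_of_mem_parts _ hB h hiB (by simp)
        rw [Finset.mem_singleton] at ha hb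
        lia
    obtain ⟨⟨b, a⟩, hp, h1 | h1⟩ := hcov i hi
    · exact loop a b hp (.inr h1.symm)
    · exact loop a b hp (.inl h1.symm)
  · intro h
    obtain ⟨B, hB, hi⟩ := (fillingPartition n hF).exists_mem (mem_Icc_of_mem_filling hT h).1
    suffices B = {i} from this ▸ hB
    refine Finset.eq_singleton_iff_unique_mem.2 ⟨hi, fun j hj => ?_⟩
    rcases ((exists_common_part_fillingPartition_iff hF).1 ⟨B, hB, hi, hj⟩).2.2 with hij | hji
    · rcases hij.cases_head with rfl | ⟨m, him, -⟩
      · rfl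
      · obtain rfl : i = m := congrArg Prod.fst (hF.2 _ h _ him.2 rfl)
        exact absurd him.1 (lt_irrefl _)
    · rcases hji.cases_tail with rfl | ⟨m, -, hmi⟩
      · rfl
      · obtain rfl : i = m := congrArg Prod.snd (hF.1 _ h _ hmi.2 rfl)
        exact absurd hmi.1 (lt_irrefl _)

theorem EMap_fillingPartition (hF : RowColAtMostOne F) (hT : F ⊆ triangle n)
    (hcov : ∀ i ∈ Finset.Icc 1 n, ∃ p ∈ F, p.1 = i ∨ p.2 = i) :
    EMap n (fillingPartition n hF) = F := by
  ext ⟨j, i⟩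
  rw [mem_EMap, IsDiagArc, isArc_fillingPartition_iff hF hT,
    singleton_mem_fillingPartition_iff hF hT hcov]
  constructor
  · rintro (h | ⟨h, h'⟩)
    · exact h.2
    · dsimp only at h h'
      subst h
      exact h'
  · intro h
    rcases (mem_Icc_of_mem_filling hT h).2.2.eq_or_lt with rfl | hlt
    · exact .inr ⟨rfl, h⟩
    · exact .inl ⟨hlt, h⟩

end Filling

/-- For `n ≥ 0`, `k ≥ 2`, the map `ℰ` is a bijection from the enhanced
`k`-noncrossing partitions of `{1,…,n}` onto the set `ℰ_n^{(k)}` of `01`-fillings of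
`△_n` with at most one `1` per row and per column, no proper SE-chain of length `k`, and
such that for each `i ∈ {1,…,n}` either row `i` or column `i` contains a `1`. -/
theorem stmt8 (n k : ℕ) (hk : 2 ≤ k) :
    Set.BijOn (EMap n)
      {P : Finpartition (Finset.Icc 1 n) | ¬ HasEnhancedKCrossing P k}
      {F : Finset (ℕ × ℕ) |
        F ⊆ triangle n ∧ RowColAtMostOne F ∧ ¬ HasProperSEChain F k ∧
        ∀ i ∈ Finset.Icc 1 n, ∃ p ∈ F, p.1 = i ∨ p.2 = i} := by
  have hk0 : k ≠ 0 := by lia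
  refine ⟨fun P hP => ⟨EMap_subset_triangle, rowColAtMostOne_EMap, ?_, fun i hi => ?_⟩,
    (EMap_injective n).injOn, ?_⟩
  · rwa [hasProperSEChain_EMap_iff hk0]
  · obtain ⟨l, h | h⟩ := exists_isDiagArc (P := P) hi
    · exact ⟨(i, l), mem_EMap.2 h, .inl rfl⟩
    · exact ⟨(l, i), mem_EMap.2 h, .inr rfl⟩
  · rintro F ⟨hT, hF, hchain, hcov⟩
    have hE := EMap_fillingPartition hF hT hcov
    refine ⟨fillingPartition n hF, ?_, hE⟩
    rwa [Set.mem_ofPred_eq, ← hasProperSEChain_EMap_iff hk0, hE]
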